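/- For every integer l ≥ 1, N'_{A_{l+1}}(1) + N'_{A_l}(1) = 0, where N'_{A_l}(1) = Σ_{J ⊆ {1,...,l}} (-1)^{#J} deg_A(J) is the derivative at t = 1 of the skew-growth function of type A_l. -/

import Mathlib

open scoped Classical

/-- Adjacency for the type `A_l` Coxeter graph (the path `1—2—⋯—l`). -/
def adjA (a b : ℕ) : Prop := b = a + 1

/-- Adjacency for the type `D_l` Coxeter graph on `{1,…,l}`: edges `{i, i+1}` for
`1 ≤ i ≤ l-2` together with the edge `{l-2, l}` (so `l-1` and `l` are not adjacent). -/
def adjD (l : ℕ) (a b : ℕ) : Prop :=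
  (b = a + 1 ∧ a ≠ l - 1) ∨ (a = l - 2 ∧ b = l)

/-- The vertex sets of the connected components of the graph induced on the finite
set `J` by the (symmetrized) adjacency relation `r`. -/
noncomputable def componentsOf (r : ℕ → ℕ → Prop) (J : Finset ℕ) : Finset (Finset ℕ) :=
  J.image fun x =>
    J.filter fun y =>
      Relation.ReflTransGen (fun a b => a ∈ J ∧ b ∈ J ∧ (r a b ∨ r b a)) x y

/-- The number of maximal blocks of consecutive integers in `J`
(the connected components of the induced subgraph of the path graph). -/
noncomputable def kA (J : Finset ℕ) : ℕ := (componentsOf adjA J).card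

/-- The degree of the fundamental element of the Artin monoid of type `A_l`
associated to `J`: the sum over the maximal consecutive blocks `B` of `J`
of `binom(#B + 1, 2)`. -/
noncomputable def degA (J : Finset ℕ) : ℕ :=
  ∑ B ∈ componentsOf adjA J, (B.card + 1).choose 2

/-- The degree of the fundamental element of the Artin monoid of type `B_l`
associated to `J`: the sum over the maximal consecutive blocks `B` of `J` of
`(#B)^2` if `{1,2} ⊆ B` and `binom(#B + 1, 2)` otherwise. -/
noncomputable def degB (J : Finset ℕ) : ℕ :=
  ∑ B ∈ componentsOf adjA J,
    if 1 ∈ B ∧ 2 ∈ B then B.card ^ 2 else (B.card + 1).choose 2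

/-- The degree of the fundamental element of the Artin monoid of type `D_l`
associated to `J`: the sum over the connected components `C` of the induced
subgraph of the type `D_l` Coxeter graph on `J` of `#C·(#C - 1)` if
`{l-1, l} ⊆ C` and `binom(#C + 1, 2)` otherwise. -/
noncomputable def degD (l : ℕ) (J : Finset ℕ) : ℕ :=
  ∑ C ∈ componentsOf (adjD l) J,
    if l - 1 ∈ C ∧ l ∈ C then C.card * (C.card - 1) else (C.card + 1).choose 2


/-- Connectivity inside `J`. -/
def ConnJ (J : Finset ℕ) : ℕ → ℕ → Prop :=
  Relation.ReflTransGen (fun a b => a ∈ J ∧ b ∈ J ∧ (adjA a b ∨ adjA b a))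

lemma connJ_symm {J : Finset ℕ} {a b : ℕ} (h : ConnJ J a b) : ConnJ J b a := by
  have hs : Std.Symm (fun a b => a ∈ J ∧ b ∈ J ∧ (adjA a b ∨ adjA b a)) :=
    ⟨fun x y h => ⟨h.2.1, h.1, h.2.2.symm⟩⟩
  exact (Relation.ReflTransGen.stdSymm).symm _ _ h

lemma connJ_interval {J : Finset ℕ} {a b : ℕ} (ha : a ∈ J) (h : ConnJ J a b) :
    ∀ c, (a ≤ c ∧ c ≤ b) ∨ (b ≤ c ∧ c ≤ a) → c ∈ J := by
  induction h with
  | refl =>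
    intro c hc
    have : c = a := by omega
    exact this ▸ ha
  | @tail b b' _ hs ih =>
    intro c hc
    obtain ⟨_, hb', hadj⟩ := hs
    unfold adjA at hadj
    by_cases h1 : c = b'
    · exact h1 ▸ hb'
    · exact ih c (by omega)

lemma connJ_of_interval {J : Finset ℕ} {a : ℕ} (n : ℕ) :
    Finset.Icc a (a + n) ⊆ J → ConnJ J a (a + n) := by
  induction n with
  | zero => intro _; exact Relation.ReflTransGen.refl
  | succ n ih =>
    intro h
    refine Relation.ReflTransGen.tail (ih ?_) ⟨h ?_, h ?_, Or.inl ?_⟩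
    · intro x hx
      apply h
      simp only [Finset.mem_Icc] at hx ⊢
      omega
    · simp only [Finset.mem_Icc]; omega
    · simp only [Finset.mem_Icc]; omega
    · unfold adjA; omega

lemma connJ_iff {J : Finset ℕ} {a b : ℕ} (ha : a ∈ J) (hab : a ≤ b) :
    ConnJ J a b ↔ Finset.Icc a b ⊆ J := by
  constructor
  · intro h c hc
    exact connJ_interval ha h c (Or.inl (Finset.mem_Icc.1 hc))
  · intro h
    obtain ⟨n, rfl⟩ := Nat.exists_eq_add_of_le hab
    exact connJ_of_interval n h

lemma card_pairs_le (B : Finset ℕ) :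
    ((B ×ˢ B).filter fun p => p.1 ≤ p.2).card = (B.card + 1).choose 2 := by
  induction B using Finset.induction_on_max with
  | empty => simp
  | insert m s hm ih =>
    have hms : m ∉ s := fun h => lt_irrefl _ (hm m h)
    have : ((insert m s ×ˢ insert m s).filter fun p : ℕ × ℕ => p.1 ≤ p.2)
        = ((s ×ˢ s).filter fun p => p.1 ≤ p.2) ∪ (insert m s) ×ˢ {m} := by
      ext ⟨a, b⟩
      simp only [Finset.mem_filter, Finset.mem_product, Finset.mem_insert, Finset.mem_union,
        Finset.mem_singleton]
      constructor
      · rintro ⟨⟨ha, hb⟩, hle⟩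
        rcases hb with rfl | hb
        · exact Or.inr ⟨ha, rfl⟩
        · rcases ha with rfl | ha
          · have := hm b hb
            omega
          · exact Or.inl ⟨⟨ha, hb⟩, hle⟩
      · rintro (⟨⟨ha, hb⟩, hle⟩ | ⟨ha, rfl⟩)
        · exact ⟨⟨Or.inr ha, Or.inr hb⟩, hle⟩
        · refine ⟨⟨ha, Or.inl rfl⟩, ?_⟩
          rcases ha with rfl | ha
          · exact le_rfl
          · exact (hm a ha).le
    rw [this, Finset.card_union_of_disjoint, ih, Finset.card_product,
      Finset.card_insert_of_notMem hms, Nat.choose_succ_succ' (s.card + 1) 1]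
    · simp
      omega
    · rw [Finset.disjoint_left]
      rintro ⟨a, b⟩ h1 h2
      simp only [Finset.mem_filter, Finset.mem_product, Finset.mem_singleton] at h1 h2
      exact hms (h2.2 ▸ h1.1.2)

lemma degA_eq (J : Finset ℕ) :
    degA J = ((J ×ˢ J).filter fun p => p.1 ≤ p.2 ∧ ConnJ J p.1 p.2).card := by
  rw [Finset.card_eq_sum_card_fiberwise (f := fun p : ℕ × ℕ => J.filter fun y => ConnJ J p.1 y)
    (t := componentsOf adjA J)]
  · unfold degA
    refine Finset.sum_congr rfl fun B hB => ?_
    rw [← card_pairs_le]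
    congr 1
    obtain ⟨x, hx, rfl⟩ := Finset.mem_image.1 hB
    change ((J.filter fun y => ConnJ J x y) ×ˢ (J.filter fun y => ConnJ J x y)).filter _ =
      Finset.filter (fun p : ℕ × ℕ => (J.filter fun y => ConnJ J p.1 y) =
        (J.filter fun y => ConnJ J x y)) _
    ext ⟨a, b⟩
    simp only [Finset.mem_filter, Finset.mem_product]
    constructor
    · rintro ⟨⟨⟨ha, hxa⟩, ⟨hb, hxb⟩⟩, hle⟩
      refine ⟨⟨⟨ha, hb⟩, hle, (connJ_symm hxa).trans hxb⟩, ?_⟩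
      ext y
      simp only [Finset.mem_filter]
      exact and_congr_right fun _ => ⟨fun h => hxa.trans h, fun h => (connJ_symm hxa).trans h⟩
    · rintro ⟨⟨⟨ha, hb⟩, hle, hab⟩, heq⟩
      have : a ∈ J.filter fun y => ConnJ J x y := by
        rw [← heq]
        exact Finset.mem_filter.2 ⟨ha, Relation.ReflTransGen.refl⟩
      have hxa := (Finset.mem_filter.1 this).2
      exact ⟨⟨⟨ha, hxa⟩, ⟨hb, hxa.trans hab⟩⟩, hle⟩
  · intro p hp
    have hp := Finset.mem_filter.1 (Finset.mem_coe.1 hp)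
    exact Finset.mem_coe.2 (Finset.mem_image.2 ⟨p.1, (Finset.mem_product.1 hp.1).1, rfl⟩)

lemma degA_eq_sum {I J : Finset ℕ} (hJ : J ⊆ I) :
    (degA J : ℤ) = ∑ p ∈ (I ×ˢ I).filter (fun p => p.1 ≤ p.2),
      if Finset.Icc p.1 p.2 ⊆ J then 1 else 0 := by
  rw [degA_eq, Finset.sum_boole]
  congr 2
  ext ⟨a, b⟩
  simp only [Finset.mem_filter, Finset.mem_product]
  constructor
  · rintro ⟨⟨ha, hb⟩, hle, h⟩
    exact ⟨⟨⟨hJ ha, hJ hb⟩, hle⟩, (connJ_iff ha hle).1 h⟩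
  · rintro ⟨⟨_, hle⟩, h⟩
    have ha : a ∈ J := h (Finset.left_mem_Icc.2 hle)
    exact ⟨⟨ha, h (Finset.right_mem_Icc.2 hle)⟩, hle, (connJ_iff ha hle).2 h⟩

lemma alt_sum_superset {I K : Finset ℕ} (hK : K ⊆ I) :
    ∑ J ∈ I.powerset, (-1 : ℤ) ^ J.card * (if K ⊆ J then 1 else 0) =
      if K = I then (-1) ^ I.card else 0 := by
  split_ifs with h
  · subst h
    rw [Finset.sum_eq_single K]
    · simp
    · intro J hJ hne
      rw [if_neg, mul_zero]
      exact fun h => hne (Finset.Subset.antisymm (Finset.mem_powerset.1 hJ) h)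
    · simp
  · obtain ⟨m, hm, hmK⟩ := Finset.exists_of_ssubset (Finset.ssubset_iff_subset_ne.2 ⟨hK, h⟩)
    rw [← Finset.insert_erase hm, Finset.sum_powerset_insert (Finset.notMem_erase m I),
      ← Finset.sum_add_distrib]
    refine Finset.sum_eq_zero fun t ht => ?_
    have hmt : m ∉ t := fun h => Finset.notMem_erase m I (Finset.mem_powerset.1 ht h)
    rw [Finset.card_insert_of_notMem hmt]
    simp only [Finset.subset_insert_iff_of_notMem hmK]
    ring

lemma sum_typeA (l : ℕ) (hl : 1 ≤ l) :
    ∑ J ∈ (Finset.Icc 1 l).powerset, (-1 : ℤ) ^ J.card * (degA J : ℤ) = (-1) ^ l := by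
  rw [Finset.sum_congr rfl fun J hJ => by
    rw [degA_eq_sum (Finset.mem_powerset.1 hJ), Finset.mul_sum], Finset.sum_comm]
  rw [Finset.sum_eq_single (1, l)]
  · rw [alt_sum_superset (Finset.Subset.refl _)]
    simp
  · rintro ⟨a, b⟩ hp hne
    simp only [Finset.mem_filter, Finset.mem_product, Finset.mem_Icc] at hp
    rw [alt_sum_superset (Finset.Icc_subset_Icc hp.1.1.1 hp.1.2.2), if_neg]
    intro h
    apply hne
    have h1 : 1 ∈ Finset.Icc a b := h ▸ Finset.left_mem_Icc.2 hl
    have h2 : l ∈ Finset.Icc a b := h ▸ Finset.right_mem_Icc.2 hl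
    rw [Finset.mem_Icc] at h1 h2
    ext <;> simp only <;> omega
  · intro h
    exact absurd (by simp [hl]) h

/-- For every integer `l ≥ 1`, `N'_{A_{l+1}}(1) + N'_{A_l}(1) = 0`, where
`N'_{A_l}(1) = Σ_{J ⊆ {1,…,l}} (-1)^{#J} deg_A(J)`. -/
theorem deriv_one_typeA_alternating (l : ℕ) (hl : 1 ≤ l) :
    (∑ J ∈ (Finset.Icc 1 (l + 1)).powerset, (-1 : ℤ) ^ J.card * (degA J : ℤ)) +
      (∑ J ∈ (Finset.Icc 1 l).powerset, (-1 : ℤ) ^ J.card * (degA J : ℤ)) = 0 := by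
  rw [sum_typeA l hl, sum_typeA (l + 1) (by omega), pow_succ]
  ring
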